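/- arXiv:1008.5141 — 7 statements merged into one kernel-verified Lean document; each statement's English description precedes it below -/
import Mathlib

section
/- Let (M,d) be a complete metric space and let S, T : M → M be mappings such that (a) T is continuous, (b) S(M) ⊆ T(M), (c) S and T commute (S(Tx) = T(Sx) for all x), and (d) d(Sx,Sy) ≤ a·d(Tx,Ty) + b·[d(Sx,Tx) + d(Sy,Ty)] + c·[d(Sx,Ty) + d(Sy,Tx)] for all x, y ∈ M, where a, b, c are nonnegative real numbers with 0 < a + 2b + 2c < 1. Then S and T have a unique common fixed point in M, i.e., there is exactly one z ∈ M with Sz = z and Tz = z. -/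
open Filter Topology

/-- A sequence `x` with `T (x (n + 1)) = S (x n)`, where `S` satisfies a Hardy–Rogers type
contraction condition relative to `T`, has Cauchy image under `S`. -/
theorem cauchySeq_of_contraction_relative {M : Type*} [PseudoMetricSpace M]
    {S T : M → M} {a b c : ℝ} (ha : 0 ≤ a) (hb : 0 ≤ b) (hc : 0 ≤ c)
    (hlt : a + 2 * b + 2 * c < 1)
    (hcontr : ∀ x y : M,
      dist (S x) (S y) ≤ a * dist (T x) (T y)
        + b * (dist (S x) (T x) + dist (S y) (T y))
        + c * (dist (S x) (T y) + dist (S y) (T x)))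
    {x : ℕ → M} (hx : ∀ n, T (x (n + 1)) = S (x n)) :
    CauchySeq fun n => S (x n) := by
  have step (n : ℕ) : dist (S (x (n + 1))) (S (x (n + 2))) ≤
      (a + 2 * b + 2 * c) * dist (S (x n)) (S (x (n + 1))) := by
    have h := hcontr (x (n + 1)) (x (n + 2))
    rw [hx n, hx (n + 1), dist_self, dist_comm (S (x (n + 1))) (S (x n)),
      dist_comm (S (x (n + 2))) (S (x (n + 1))),
      dist_comm (S (x (n + 2))) (S (x n))] at h
    have htri := mul_le_mul_of_nonneg_left
      (dist_triangle (S (x n)) (S (x (n + 1))) (S (x (n + 2)))) hc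
    have hd : 0 ≤ dist (S (x n)) (S (x (n + 1))) := dist_nonneg
    generalize dist (S (x n)) (S (x (n + 1))) = d at *
    generalize dist (S (x (n + 1))) (S (x (n + 2))) = e at *
    have hle : e ≤ d := by
      by_contra! hlt'
      nlinarith
    nlinarith
  refine cauchySeq_of_le_geometric _ (dist (S (x 0)) (S (x 1))) hlt fun n => ?_
  induction n with
  | zero => simp
  | succ n ih =>
    calc dist (S (x (n + 1))) (S (x (n + 2)))
        ≤ (a + 2 * b + 2 * c) * dist (S (x n)) (S (x (n + 1))) := step n
      _ ≤ (a + 2 * b + 2 * c) * (dist (S (x 0)) (S (x 1)) * (a + 2 * b + 2 * c) ^ n) := by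
          gcongr
      _ = dist (S (x 0)) (S (x 1)) * (a + 2 * b + 2 * c) ^ (n + 1) := by ring

/-- Singh's common fixed point theorem for commuting mappings in a complete metric space. -/
theorem singh_fixed_point {M : Type*} [MetricSpace M] [CompleteSpace M] [Nonempty M]
    (S T : M → M) (a b c : ℝ)
    (hT : Continuous T)
    (hrange : Set.range S ⊆ Set.range T)
    (hcomm : ∀ x : M, S (T x) = T (S x))
    (ha : 0 ≤ a) (hb : 0 ≤ b) (hc : 0 ≤ c)
    (hpos : 0 < a + 2 * b + 2 * c) (hlt : a + 2 * b + 2 * c < 1)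
    (hcontr : ∀ x y : M,
      dist (S x) (S y) ≤ a * dist (T x) (T y)
        + b * (dist (S x) (T x) + dist (S y) (T y))
        + c * (dist (S x) (T y) + dist (S y) (T x))) :
    ∃! z : M, S z = z ∧ T z = z := by
  choose g hg using fun x => hrange (Set.mem_range_self x)
  obtain ⟨p⟩ := ‹Nonempty M›
  let x : ℕ → M := fun n => g^[n] p
  have hx (n : ℕ) : T (x (n + 1)) = S (x n) := by
    simp only [x, Function.iterate_succ_apply', hg]
  obtain ⟨z, hz⟩ := cauchySeq_tendsto_of_complete
    (cauchySeq_of_contraction_relative ha hb hc hlt hcontr hx)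
  have hz' : Tendsto (fun n => S (x (n + 1))) atTop (𝓝 z) := hz.comp (tendsto_add_atTop_nat 1)
  have hTS : Tendsto (fun n => T (S (x n))) atTop (𝓝 (T z)) := (hT.tendsto z).comp hz
  have hSS : Tendsto (fun n => S (S (x n))) atTop (𝓝 (T z)) := by
    have h : Tendsto (fun n => T (S (x (n + 1)))) atTop (𝓝 (T z)) := (hT.tendsto z).comp hz'
    simpa only [← hcomm, hx] using h
  have hTz : T z = z := by
    have h := le_of_tendsto_of_tendsto' (hSS.dist hz')
      ((((hTS.dist hz).const_mul a).add
        (((hSS.dist hTS).add (hz'.dist hz)).const_mul b)).add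
        (((hSS.dist hz).add (hz'.dist hTS)).const_mul c))
      fun n => by simpa only [hx] using hcontr (S (x n)) (x (n + 1))
    rw [dist_self, dist_self, dist_comm z (T z)] at h
    have hd : 0 ≤ dist (T z) z := dist_nonneg
    exact dist_le_zero.mp (by nlinarith)
  have hSz : S z = z := by
    have hc' : Tendsto (fun _ : ℕ => S z) atTop (𝓝 (S z)) := tendsto_const_nhds
    have ht' : Tendsto (fun _ : ℕ => T z) atTop (𝓝 z) := by simp [hTz]
    have h := le_of_tendsto_of_tendsto' (hc'.dist hz')
      ((((ht'.dist hz).const_mul a).add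
        (((hc'.dist ht').add (hz'.dist hz)).const_mul b)).add
        (((hc'.dist hz).add (hz'.dist ht')).const_mul c))
      fun n => by simpa only [hx] using hcontr z (x (n + 1))
    rw [dist_self] at h
    have hd : 0 ≤ dist (S z) z := dist_nonneg
    exact dist_le_zero.mp (by nlinarith)
  refine ⟨z, ⟨hSz, hTz⟩, ?_⟩
  rintro w ⟨hSw, hTw⟩
  have h := hcontr w z
  rw [hSw, hTw, hSz, hTz, dist_self, dist_self, dist_comm z w] at h
  have hd : 0 ≤ dist w z := dist_nonneg
  exact dist_le_zero.mp (by nlinarith)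
end

section
/- Let (M,d) be a cone metric space over a real Banach space E with cone P, where P is normal with normal constant K. Then a sequence (xₙ) in M converges (in the cone-metric sense) to x ∈ M if and only if d(xₙ,x) → 0 in the norm of E, i.e., ‖d(xₙ,x)‖ → 0 as n → ∞. -/
/-- `P` is a cone in the real Banach space `E`. -/
def IsCone {E : Type*} [NormedAddCommGroup E] [NormedSpace ℝ E] (P : Set E) : Prop :=
  IsClosed P ∧ P.Nonempty ∧ P ≠ {0} ∧
    (∀ a b : ℝ, 0 ≤ a → 0 ≤ b → ∀ x ∈ P, ∀ y ∈ P, a • x + b • y ∈ P) ∧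
    P ∩ (-P) = {0}

/-- The partial order induced by the cone `P`: `x ≤ y` iff `y - x ∈ P`. -/
def ConeLe {E : Type*} [NormedAddCommGroup E] [NormedSpace ℝ E] (P : Set E) (x y : E) : Prop :=
  y - x ∈ P

/-- `x ≪ y` iff `y - x ∈ interior P`. -/
def ConeLt {E : Type*} [NormedAddCommGroup E] [NormedSpace ℝ E] (P : Set E) (x y : E) : Prop :=
  y - x ∈ interior P

/-- `P` is a normal cone with normal constant `K`. -/
def IsNormalCone {E : Type*} [NormedAddCommGroup E] [NormedSpace ℝ E] (P : Set E) (K : ℝ) : Prop :=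
  0 < K ∧ ∀ x y : E, ConeLe P 0 x → ConeLe P x y → ‖x‖ ≤ K * ‖y‖

/-- `d` is a cone metric on `M` with respect to the cone `P`. -/
def IsConeMetric {E M : Type*} [NormedAddCommGroup E] [NormedSpace ℝ E]
    (P : Set E) (d : M → M → E) : Prop :=
  (∀ x y : M, ConeLe P 0 (d x y)) ∧
  (∀ x y : M, d x y = 0 ↔ x = y) ∧
  (∀ x y : M, d x y = d y x) ∧
  (∀ x y z : M, ConeLe P (d x y) (d x z + d z y))

/-- Convergence of a sequence in a cone metric space. -/
def ConeConv {E M : Type*} [NormedAddCommGroup E] [NormedSpace ℝ E]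
    (P : Set E) (d : M → M → E) (u : ℕ → M) (x : M) : Prop :=
  ∀ c : E, ConeLt P 0 c → ∃ n₀ : ℕ, ∀ n ≥ n₀, ConeLt P (d (u n) x) c

/-- Cauchy sequences in a cone metric space. -/
def ConeCauchy {E M : Type*} [NormedAddCommGroup E] [NormedSpace ℝ E]
    (P : Set E) (d : M → M → E) (u : ℕ → M) : Prop :=
  ∀ c : E, ConeLt P 0 c → ∃ n₀ : ℕ, ∀ n ≥ n₀, ∀ m ≥ n₀, ConeLt P (d (u n) (u m)) c

/-- Completeness of a cone metric space. -/
def ConeComplete {E M : Type*} [NormedAddCommGroup E] [NormedSpace ℝ E]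
    (P : Set E) (d : M → M → E) : Prop :=
  ∀ u : ℕ → M, ConeCauchy P d u → ∃ x : M, ConeConv P d u x

/-- Sequential continuity of a self-map of a cone metric space. -/
def ConeSeqContinuous {E M : Type*} [NormedAddCommGroup E] [NormedSpace ℝ E]
    (P : Set E) (d : M → M → E) (T : M → M) : Prop :=
  ∀ (u : ℕ → M) (x : M), ConeConv P d u x → ConeConv P d (fun n => T (u n)) (T x)

/-- `(S, T)` is a pair of generalized Zamfirescu operators with constants `a`, `b`, `c`. -/
def IsGZO {E M : Type*} [NormedAddCommGroup E] [NormedSpace ℝ E]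
    (P : Set E) (d : M → M → E) (S T : M → M) (a b c : ℝ) : Prop :=
  0 ≤ a ∧ a < 1 ∧ 0 ≤ b ∧ b < 1/2 ∧ 0 ≤ c ∧ c < 1/2 ∧
    ∀ x y : M,
      ConeLe P (d (S x) (S y)) (a • d (T x) (T y)) ∨
      ConeLe P (d (S x) (S y)) (b • (d (S x) (T x) + d (S y) (T y))) ∨
      ConeLe P (d (S x) (S y)) (c • (d (S x) (T y) + d (S y) (T x)))

/-- `(S, T)` is a generalized weak contraction. -/
def IsGWC {E M : Type*} [NormedAddCommGroup E] [NormedSpace ℝ E]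
    (P : Set E) (d : M → M → E) (S T : M → M) : Prop :=
  ∃ δ L : ℝ, 0 < δ ∧ δ < 1 ∧ 0 ≤ L ∧
    ∀ x y : M, ConeLe P (d (S x) (S y)) (δ • d (T x) (T y) + L • d (S x) (T x))

open scoped Pointwise in
/-- The interior of a cone is stable under multiplication by positive scalars. -/
theorem IsCone.smul_mem_interior {E : Type*} [NormedAddCommGroup E] [NormedSpace ℝ E]
    {P : Set E} (hP : IsCone P) {a : ℝ} (ha : 0 < a) {c : E} (hc : c ∈ interior P) :
    a • c ∈ interior P := by
  obtain ⟨-, -, -, hcomb, -⟩ := hP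
  have hsub : a • P ⊆ P := by
    rintro _ ⟨y, hy, rfl⟩
    simpa using hcomb a 0 ha.le le_rfl y hy y hy
  have hmem : a • c ∈ interior (a • P) := by
    rw [interior_smul₀ ha.ne']
    exact Set.smul_mem_smul_set hc
  exact interior_mono hsub hmem

/-- In a cone metric space over a normal cone, convergence is equivalent to norm convergence
of the distances to the limit. -/
theorem coneConv_iff_norm_tendsto {E M : Type*} [NormedAddCommGroup E] [NormedSpace ℝ E]
    [CompleteSpace E] [Nonempty M]
    (P : Set E) (K : ℝ) (d : M → M → E)
    (hP : IsCone P) (hint : (interior P).Nonempty) (hK : IsNormalCone P K)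
    (hd : IsConeMetric P d) (u : ℕ → M) (x : M) :
    ConeConv P d u x ↔
      Filter.Tendsto (fun n => ‖d (u n) x‖) Filter.atTop (nhds 0) := by
  constructor
  · intro h
    obtain ⟨c, hc⟩ := hint
    obtain ⟨hKpos, hnormal⟩ := hK
    rw [Metric.tendsto_atTop]
    intro ε hε
    have hpos : 0 < K * ‖c‖ + 1 := by positivity
    set t : ℝ := ε / (K * ‖c‖ + 1)
    have htpos : 0 < t := by positivity
    obtain ⟨n₀, hn₀⟩ := h (t • c) (by simpa [ConeLt] using hP.smul_mem_interior htpos hc)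
    refine ⟨n₀, fun n hn => ?_⟩
    have hle := hnormal _ _ (hd.1 (u n) x) (interior_subset (hn₀ n hn))
    rw [norm_smul, Real.norm_of_nonneg htpos.le] at hle
    have hε_eq : t * (K * ‖c‖ + 1) = ε := div_mul_cancel₀ ε hpos.ne'
    rw [Real.dist_0_eq_abs, abs_norm]
    linarith
  · intro h c hc
    have hlim : Filter.Tendsto (fun n => c - d (u n) x) Filter.atTop (nhds (c - 0)) :=
      tendsto_const_nhds.sub (tendsto_zero_iff_norm_tendsto_zero.mpr h)
    exact Filter.eventually_atTop.mp (hlim.eventually (isOpen_interior.mem_nhds hc))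
end

section
/- Let (M,d) be a cone metric space over a real Banach space E with cone P, where P is normal with normal constant K. If (xₙ) is a sequence in M and a ∈ (0,1) is a real number such that d(xₙ₊₁,xₙ) ≤ a·d(xₙ,xₙ₋₁) for every n ≥ 1, then (xₙ) is a Cauchy sequence in M. -/
section ConeLemmas

open scoped Pointwise

variable {E M : Type*} [NormedAddCommGroup E] [NormedSpace ℝ E] {P : Set E}

theorem IsCone.add_mem (hP : IsCone P) {x y : E} (hx : x ∈ P) (hy : y ∈ P) : x + y ∈ P := by
  simpa using hP.2.2.2.1 1 1 zero_le_one zero_le_one x hx y hy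

theorem IsCone.smul_mem (hP : IsCone P) {r : ℝ} (hr : 0 ≤ r) {x : E} (hx : x ∈ P) :
    r • x ∈ P := by
  simpa using hP.2.2.2.1 r 0 hr le_rfl x hx x hx

theorem ConeLe.trans (hP : IsCone P) {x y z : E} (hxy : ConeLe P x y) (hyz : ConeLe P y z) :
    ConeLe P x z := by
  simpa [ConeLe] using hP.add_mem hyz hxy

theorem ConeLe.add (hP : IsCone P) {x y z w : E} (hxy : ConeLe P x y) (hzw : ConeLe P z w) :
    ConeLe P (x + z) (y + w) := by
  simpa [ConeLe, add_sub_add_comm] using hP.add_mem hxy hzw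

theorem ConeLe.smul (hP : IsCone P) {r : ℝ} (hr : 0 ≤ r) {x y : E} (hxy : ConeLe P x y) :
    ConeLe P (r • x) (r • y) := by
  simpa [ConeLe, smul_sub] using hP.smul_mem hr hxy

theorem ConeLe.smul_right (hP : IsCone P) {r s : ℝ} (hrs : r ≤ s) {x : E} (hx : x ∈ P) :
    ConeLe P (r • x) (s • x) := by
  simpa [ConeLe, sub_smul] using hP.smul_mem (sub_nonneg.2 hrs) hx

theorem ConeLe.trans_coneLt (hP : IsCone P) {x y z : E} (hxy : ConeLe P x y)
    (hyz : ConeLt P y z) : ConeLt P x z := by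
  have hsub : P + interior P ⊆ interior P :=
    interior_maximal
      (Set.add_subset_iff.2 fun _ hp _ hq => hP.add_mem hp (interior_subset hq))
      isOpen_interior.add_left
  simpa [ConeLt] using hsub (Set.add_mem_add hxy hyz)

variable {d : M → M → E} {u : ℕ → M} {a : ℝ}

theorem coneLe_pow_smul_of_contractive (hP : IsCone P) (hd : IsConeMetric P d) (ha : 0 ≤ a)
    (hcontr : ∀ n : ℕ, 1 ≤ n → ConeLe P (d (u (n + 1)) (u n)) (a • d (u n) (u (n - 1))))
    (n : ℕ) : ConeLe P (d (u n) (u (n + 1))) (a ^ n • d (u 1) (u 0)) := by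
  rw [hd.2.2.1]
  induction n with
  | zero =>
    have hD : d (u 1) (u 0) ∈ P := by simpa [ConeLe] using hd.1 (u 1) (u 0)
    simpa using ConeLe.smul_right hP (le_refl 1) hD
  | succ n ih =>
    have h := (hcontr (n + 1) (by lia)).trans hP (ih.smul hP ha)
    rwa [smul_smul, ← pow_succ'] at h

theorem coneLe_geometric_of_contractive (hP : IsCone P) (hd : IsConeMetric P d) (ha : 0 ≤ a)
    (ha1 : a < 1)
    (hcontr : ∀ n : ℕ, 1 ≤ n → ConeLe P (d (u (n + 1)) (u n)) (a • d (u n) (u (n - 1))))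
    (n k : ℕ) : ConeLe P (d (u n) (u (n + k))) ((a ^ n / (1 - a)) • d (u 1) (u 0)) := by
  have h1a : 0 < 1 - a := sub_pos.2 ha1
  induction k generalizing n with
  | zero =>
    have hD : d (u 1) (u 0) ∈ P := by simpa [ConeLe] using hd.1 (u 1) (u 0)
    have h0 : d (u n) (u n) = 0 := (hd.2.1 _ _).2 rfl
    simpa [ConeLe, h0] using hP.smul_mem (by positivity : 0 ≤ a ^ n / (1 - a)) hD
  | succ k ih =>
    have h := (hd.2.2.2 (u n) (u (n + 1 + k)) (u (n + 1))).trans hP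
      ((coneLe_pow_smul_of_contractive hP hd ha hcontr n).add hP (ih (n + 1)))
    have hsum : a ^ n + a ^ (n + 1) / (1 - a) = a ^ n / (1 - a) := by
      field_simp
      ring
    rwa [← add_smul, hsum, add_right_comm n 1 k] at h

end ConeLemmas

/-- If consecutive distances contract by a factor a ∈ (0,1), the sequence is Cauchy. -/
theorem coneCauchy_of_contractive {E M : Type*} [NormedAddCommGroup E] [NormedSpace ℝ E]
    [CompleteSpace E] [Nonempty M]
    (P : Set E) (K : ℝ) (d : M → M → E)
    (hP : IsCone P) (hint : (interior P).Nonempty) (hK : IsNormalCone P K)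
    (hd : IsConeMetric P d) (u : ℕ → M) (a : ℝ) (ha0 : 0 < a) (ha1 : a < 1)
    (hcontr : ∀ n : ℕ, 1 ≤ n → ConeLe P (d (u (n + 1)) (u n)) (a • d (u n) (u (n - 1)))) :
    ConeCauchy P d u := by
  intro c hc
  have hlim : Filter.Tendsto (fun n : ℕ => c - (a ^ n / (1 - a)) • d (u 1) (u 0))
      Filter.atTop (nhds (c - 0)) := by
    have h := (((tendsto_pow_atTop_nhds_zero_of_lt_one ha0.le ha1).div_const
      (1 - a)).smul_const (d (u 1) (u 0))).const_sub c
    simpa using h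
  obtain ⟨N, hN⟩ := (hlim.eventually (isOpen_interior.mem_nhds hc)).exists
  have hD : d (u 1) (u 0) ∈ P := by simpa [ConeLe] using hd.1 (u 1) (u 0)
  have key : ∀ n ≥ N, ∀ m ≥ n, ConeLt P (d (u n) (u m)) c := by
    intro n hn m hm
    obtain ⟨k, rfl⟩ := Nat.exists_eq_add_of_le hm
    have hpow : a ^ n / (1 - a) ≤ a ^ N / (1 - a) :=
      div_le_div_of_nonneg_right (pow_le_pow_of_le_one ha0.le ha1.le hn) (sub_pos.2 ha1).le
    exact ((coneLe_geometric_of_contractive hP hd ha0.le ha1 hcontr n k).trans hP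
      (ConeLe.smul_right hP hpow hD)).trans_coneLt hP hN
  refine ⟨N, fun n hn m hm => ?_⟩
  rcases le_total n m with h | h
  · exact key n hn m h
  · rw [hd.2.2.1]
    exact key m hm n h
end

section
/- Let (M,d) be a complete metric space and let S, T : M → M be mappings such that T is continuous, S(M) ⊆ T(M), S and T commute, and d(Sx,Sy) ≤ a·d(Tx,Ty) for all x, y ∈ M, where 0 ≤ a < 1. Then S and T have a unique common fixed point. -/
/-- Jungck's common fixed point theorem in a complete metric space. -/
theorem jungck_fixed_point {M : Type*} [MetricSpace M] [CompleteSpace M] [Nonempty M]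
    (S T : M → M) (a : ℝ)
    (hT : Continuous T)
    (hrange : Set.range S ⊆ Set.range T)
    (hcomm : ∀ x : M, S (T x) = T (S x))
    (ha : 0 ≤ a) (ha1 : a < 1)
    (hcontr : ∀ x y : M, dist (S x) (S y) ≤ a * dist (T x) (T y)) :
    ∃! z : M, S z = z ∧ T z = z := by
  have eq_of_dist_le : ∀ u v : M, dist u v ≤ a * dist u v → u = v := fun u v h =>
    dist_le_zero.mp (by nlinarith [dist_nonneg (x := u) (y := v)])
  have hS : Continuous S := by
    refine continuous_iff_continuousAt.mpr fun x => tendsto_iff_dist_tendsto_zero.mpr ?_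
    have hlim : Filter.Tendsto (fun y => a * dist (T y) (T x)) (nhds x) (nhds 0) := by
      simpa using (tendsto_iff_dist_tendsto_zero.mp (hT.tendsto x)).const_mul a
    exact squeeze_zero (fun _ => dist_nonneg) (fun y => hcontr y x) hlim
  choose g hg using fun x => hrange (Set.mem_range_self x)
  -- The Jungck sequence `S (x n) = T (x (n + 1))`.
  let x : ℕ → M := fun n => g^[n] (Classical.arbitrary M)
  have hx : ∀ n, T (x (n + 1)) = S (x n) := fun n => by
    simp only [x, Function.iterate_succ_apply', hg]
  have hdist : ∀ n, dist (S (x n)) (S (x (n + 1))) ≤ dist (S (x 0)) (S (x 1)) * a ^ n := by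
    intro n
    induction n with
    | zero => simp
    | succ n ih =>
      calc dist (S (x (n + 1))) (S (x (n + 1 + 1)))
          ≤ a * dist (S (x n)) (S (x (n + 1))) := by
            simpa only [hx] using hcontr (x (n + 1)) (x (n + 1 + 1))
        _ ≤ a * (dist (S (x 0)) (S (x 1)) * a ^ n) := by gcongr
        _ = dist (S (x 0)) (S (x 1)) * a ^ (n + 1) := by ring
  obtain ⟨t, ht⟩ := cauchySeq_tendsto_of_complete (cauchySeq_of_le_geometric a _ ha1 hdist)
  have hST : S t = T t := by
    refine tendsto_nhds_unique ((hS.tendsto t).comp ht) ?_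
    refine ((hT.tendsto t).comp (ht.comp (Filter.tendsto_add_atTop_nat 1))).congr fun n => ?_
    simp only [Function.comp_apply, ← hcomm, hx]
  have hfix : S (S t) = S t := by
    refine (eq_of_dist_le _ _ ?_).symm
    simpa only [← hcomm, ← hST] using hcontr t (S t)
  refine ⟨S t, ⟨hfix, by rw [← hcomm, ← hST, hfix]⟩, ?_⟩
  rintro w ⟨hSw, hTw⟩
  refine eq_of_dist_le _ _ ?_
  have h := hcontr w (S t)
  rwa [← hcomm, ← hST, hSw, hTw, hfix] at h
end

section
/- Let (M,d) be a cone metric space over a real Banach space E with cone P, and let S, T : M → M be a pair of generalized Zamfirescu operators with constants a, b, c. Set δ = max{a, b/(1−b), c/(1−c)}; then 0 ≤ δ < 1 and d(Sx,Sy) ≤ δ·d(Tx,Ty) + 2δ·d(Sx,Tx) for all x, y ∈ M. -/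
theorem IsCone.add_mem_s10 {E : Type*} [NormedAddCommGroup E] [NormedSpace ℝ E] {P : Set E}
    (hP : IsCone P) {u v : E} (hu : u ∈ P) (hv : v ∈ P) : u + v ∈ P := by
  simpa using hP.2.2.2.1 1 1 zero_le_one zero_le_one u hu v hv

theorem IsCone.smul_mem_s10 {E : Type*} [NormedAddCommGroup E] [NormedSpace ℝ E] {P : Set E}
    (hP : IsCone P) {r : ℝ} (hr : 0 ≤ r) {u : E} (hu : u ∈ P) : r • u ∈ P := by
  simpa using hP.2.2.2.1 r 0 hr le_rfl u hu u hu

/-- A self-referential bound `u ≤ k (u + w)` with `k < 1` can be solved for `u`. -/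
theorem IsCone.coneLe_smul_of_coneLe_smul_add {E : Type*} [NormedAddCommGroup E]
    [NormedSpace ℝ E] {P : Set E} (hP : IsCone P) {k δ : ℝ} (hk : k < 1)
    (hkδ : k / (1 - k) ≤ δ) {u w : E} (hw : w ∈ P) (h : ConeLe P u (k • (u + w))) :
    ConeLe P u (δ • w) := by
  have hk' : 0 < 1 - k := sub_pos.2 hk
  have key := hP.add_mem_s10 (hP.smul_mem_s10 (inv_nonneg.2 hk'.le) h)
    (hP.smul_mem_s10 (sub_nonneg.2 hkδ) hw)
  unfold ConeLe
  convert key using 1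
  match_scalars <;> field_simp <;> ring

/-- A pair of generalized Zamfirescu operators satisfies
d(Sx,Sy) ≤ δ·d(Tx,Ty) + 2δ·d(Sx,Tx) with δ = max{a, b/(1-b), c/(1-c)} ∈ [0,1). -/
theorem gzo_ineq_a {E M : Type*} [NormedAddCommGroup E] [NormedSpace ℝ E]
    [CompleteSpace E] [Nonempty M]
    (P : Set E) (d : M → M → E)
    (hP : IsCone P) (hint : (interior P).Nonempty) (hd : IsConeMetric P d)
    (S T : M → M) (a b c : ℝ) (hGZO : IsGZO P d S T a b c)
    (δ : ℝ) (hδ : δ = max a (max (b / (1 - b)) (c / (1 - c)))) :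
    0 ≤ δ ∧ δ < 1 ∧
      ∀ x y : M, ConeLe P (d (S x) (S y))
        (δ • d (T x) (T y) + (2 * δ) • d (S x) (T x)) := by
  obtain ⟨ha, ha1, hb, hb1, hc, hc1, hST⟩ := hGZO
  obtain ⟨hpos, -, hsymm, htri⟩ := hd
  have hmem (x y : M) : d x y ∈ P := by simpa [ConeLe] using hpos x y
  have haδ : a ≤ δ := hδ ▸ le_max_left _ _
  have hbδ : b / (1 - b) ≤ δ := hδ ▸ (le_max_left _ _).trans (le_max_right _ _)
  have hcδ : c / (1 - c) ≤ δ := hδ ▸ (le_max_right _ _).trans (le_max_right _ _)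
  have hδ0 : 0 ≤ δ := ha.trans haδ
  refine ⟨hδ0, ?_, fun x y => ?_⟩
  · rw [hδ, max_lt_iff, max_lt_iff, div_lt_one (by linarith), div_lt_one (by linarith)]
    exact ⟨ha1, by linarith, by linarith⟩
  have hw : d (T x) (T y) + (2 : ℝ) • d (S x) (T x) ∈ P :=
    hP.add_mem_s10 (hmem _ _) (hP.smul_mem_s10 zero_le_two (hmem _ _))
  have hrw : δ • d (T x) (T y) + (2 * δ) • d (S x) (T x) =
      δ • (d (T x) (T y) + (2 : ℝ) • d (S x) (T x)) := by module
  have hSxTy := htri (S x) (T y) (T x)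
  rcases hST x y with h | h | h
  · have key := hP.add_mem_s10 h (hP.add_mem_s10 (hP.smul_mem_s10 (sub_nonneg.2 haδ) (hmem (T x) (T y)))
      (hP.smul_mem_s10 (mul_nonneg zero_le_two hδ0) (hmem (S x) (T x))))
    unfold ConeLe
    convert key using 1
    module
  · rw [hrw]
    refine hP.coneLe_smul_of_coneLe_smul_add (by linarith) hbδ hw ?_
    have hSyTy := htri (S y) (T y) (S x)
    rw [hsymm (S y) (S x)] at hSyTy
    have key := hP.add_mem_s10 h (hP.smul_mem_s10 hb (hP.add_mem_s10 hSyTy hSxTy))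
    unfold ConeLe
    convert key using 1
    module
  · rw [hrw]
    refine hP.coneLe_smul_of_coneLe_smul_add (by linarith) hcδ hw ?_
    have hSyTx := htri (S y) (T x) (S x)
    rw [hsymm (S y) (S x)] at hSyTx
    have key := hP.add_mem_s10 h (hP.smul_mem_s10 hc (hP.add_mem_s10 hSyTx hSxTy))
    unfold ConeLe
    convert key using 1
    module
end

section
/- Let (M,d) be a cone metric space over a real Banach space E with cone P, and let S, T : M → M be a pair of generalized Zamfirescu operators with constants a, b, c. Set δ = max{a, b/(1−b), c/(1−c)}; then 0 ≤ δ < 1 and d(Sx,Sy) ≤ δ·d(Tx,Ty) + 2δ·d(Sy,Tx) for all x, y ∈ M. -/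
namespace IsCone

variable {E : Type*} [NormedAddCommGroup E] [NormedSpace ℝ E] {P : Set E}

theorem add_mem_s11 (hP : IsCone P) {x y : E} (hx : x ∈ P) (hy : y ∈ P) : x + y ∈ P := by
  simpa using hP.2.2.2.1 1 1 zero_le_one zero_le_one x hx y hy

theorem smul_mem_s11 (hP : IsCone P) {r : ℝ} (hr : 0 ≤ r) {x : E} (hx : x ∈ P) : r • x ∈ P := by
  simpa using hP.2.2.2.1 r 0 hr le_rfl x hx x hx

theorem coneLe_smul_of_coneLe_smul_add_s11 (hP : IsCone P) {k δ : ℝ} (hk : k < 1)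
    (hδ : k / (1 - k) ≤ δ) {x w : E} (hw : w ∈ P) (h : ConeLe P x (k • (x + w))) :
    ConeLe P x (δ • w) := by
  have hk' : 0 < 1 - k := sub_pos.2 hk
  have key := hP.add_mem_s11 (hP.smul_mem_s11 (inv_nonneg.2 hk'.le) h)
    (hP.smul_mem_s11 (sub_nonneg.2 hδ) hw)
  unfold ConeLe
  convert key using 1
  match_scalars <;> field_simp <;> ring

theorem coneLe_smul_trans (hP : IsCone P) {k : ℝ} (hk : 0 ≤ k) {x y z : E}
    (h : ConeLe P x (k • y)) (hyz : ConeLe P y z) : ConeLe P x (k • z) := by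
  have key := hP.add_mem_s11 h (hP.smul_mem_s11 hk hyz)
  unfold ConeLe
  convert key using 1
  module

end IsCone

theorem div_one_sub_lt_one {k : ℝ} (hk : k < 1 / 2) : k / (1 - k) < 1 := by
  rw [div_lt_one (by linarith)]
  linarith

/-- A pair of generalized Zamfirescu operators satisfies
d(Sx,Sy) ≤ δ·d(Tx,Ty) + 2δ·d(Sy,Tx) with δ = max{a, b/(1-b), c/(1-c)} ∈ [0,1). -/
theorem gzo_ineq_b {E M : Type*} [NormedAddCommGroup E] [NormedSpace ℝ E]
    [CompleteSpace E] [Nonempty M]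
    (P : Set E) (d : M → M → E)
    (hP : IsCone P) (hint : (interior P).Nonempty) (hd : IsConeMetric P d)
    (S T : M → M) (a b c : ℝ) (hGZO : IsGZO P d S T a b c)
    (δ : ℝ) (hδ : δ = max a (max (b / (1 - b)) (c / (1 - c)))) :
    0 ≤ δ ∧ δ < 1 ∧
      ∀ x y : M, ConeLe P (d (S x) (S y))
        (δ • d (T x) (T y) + (2 * δ) • d (S y) (T x)) := by
  obtain ⟨ha0, ha1, hb0, hb1, hc0, hc1, h⟩ := hGZO
  obtain ⟨hnonneg, -, -, htri⟩ := hd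
  have haδ : a ≤ δ := hδ ▸ le_max_left _ _
  have hbδ : b / (1 - b) ≤ δ := hδ ▸ (le_max_left _ _).trans (le_max_right _ _)
  have hcδ : c / (1 - c) ≤ δ := hδ ▸ (le_max_right _ _).trans (le_max_right _ _)
  have hδ0 : 0 ≤ δ := ha0.trans haδ
  refine ⟨hδ0, hδ ▸ max_lt ha1 (max_lt (div_one_sub_lt_one hb1) (div_one_sub_lt_one hc1)), ?_⟩
  intro x y
  have hmem (p q : M) : d p q ∈ P := by simpa [ConeLe] using hnonneg p q
  have hw : d (T x) (T y) + (2 : ℝ) • d (S y) (T x) ∈ P :=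
    hP.add_mem_s11 (hmem _ _) (hP.smul_mem_s11 zero_le_two (hmem _ _))
  have hSyTy := htri (S y) (T y) (T x)
  have hrw : δ • d (T x) (T y) + (2 * δ) • d (S y) (T x) =
      δ • (d (T x) (T y) + (2 : ℝ) • d (S y) (T x)) := by module
  rcases h x y with h | h | h
  · have key := hP.add_mem_s11 h (hP.add_mem_s11 (hP.smul_mem_s11 (sub_nonneg.2 haδ) (hmem (T x) (T y)))
      (hP.smul_mem_s11 (mul_nonneg zero_le_two hδ0) (hmem (S y) (T x))))
    unfold ConeLe
    convert key using 1
    module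
  · rw [hrw]
    refine hP.coneLe_smul_of_coneLe_smul_add_s11 (by linarith) hbδ hw
      (hP.coneLe_smul_trans hb0 h ?_)
    have key := hP.add_mem_s11 (htri (S x) (T x) (S y)) hSyTy
    unfold ConeLe
    convert key using 1
    module
  · rw [hrw]
    refine hP.coneLe_smul_of_coneLe_smul_add_s11 (by linarith) hcδ hw
      (hP.coneLe_smul_trans hc0 h ?_)
    have key := hP.add_mem_s11 (htri (S x) (T y) (S y)) hSyTy
    unfold ConeLe
    convert key using 1
    module
end

section
/- Let (M,d) be a cone metric space over a real Banach space E with cone P, and let S, T : M → M. If the pair (S,T) is a generalized Chatterjea contraction, i.e., there exists 0 ≤ c < 1/2 such that d(Sx,Sy) ≤ c·[d(Sx,Ty) + d(Sy,Tx)] for all x, y ∈ M, then (S,T) is a generalized weak contraction. -/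
/-- A generalized Chatterjea contraction pair is a generalized weak contraction. -/
theorem gwc_of_gcc {E M : Type*} [NormedAddCommGroup E] [NormedSpace ℝ E]
    [CompleteSpace E] [Nonempty M]
    (P : Set E) (d : M → M → E)
    (hP : IsCone P) (hint : (interior P).Nonempty) (hd : IsConeMetric P d)
    (S T : M → M) (c : ℝ) (hc : 0 ≤ c) (hc1 : c < 1/2)
    (hcontr : ∀ x y : M,
      ConeLe P (d (S x) (S y)) (c • (d (S x) (T y) + d (S y) (T x)))) :
    IsGWC P d S T := by
  obtain ⟨-, -, -, hcone, -⟩ := hP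
  obtain ⟨hnonneg, -, hsymm, htri⟩ := hd
  have hc2 : 0 < 1 - c := by linarith
  refine ⟨1 / (2 * (1 - c)), 2 * c / (1 - c), by positivity, ?_, by positivity, fun x y => ?_⟩
  · rw [div_lt_one (by positivity)]
    linarith
  have hTT := hnonneg (T x) (T y)
  have hST := htri (S x) (T y) (T x)
  have hSS := htri (S y) (T x) (S x)
  have hxy := hcontr x y
  rw [hsymm (S y) (S x)] at hSS
  unfold ConeLe at *
  have htriangles := hcone c c hc hc _ hST _ hSS
  have hrest := hcone 1 (1 / 2 - c) zero_le_one (by linarith) _ hxy _ hTT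
  have hsum := hcone (1 - c)⁻¹ (1 - c)⁻¹ (by positivity) (by positivity) _ htriangles _ hrest
  convert hsum using 1
  match_scalars <;> field_simp <;> ring
end
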